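/- Let 𝒱 = {φ_Λ}_{Λ∈𝒞} and 𝒱' = {ψ_Λ}_{Λ∈𝒞} be positive specifications on X = S^ℤ. If φ_{{n}} = ψ_{{n}} for every n ∈ ℤ, then φ_Λ = ψ_Λ for every Λ ∈ 𝒞; that is, a positive specification is completely determined by its single-site functions. -/

import Mathlib

open MeasureTheory Filter Set Asymptotics

noncomputable section

namespace GibbsFormal

/-- The configuration space `X = S^ℤ`. -/
abbrev Conf (S : Type) := ℤ → S

variable {S : Type} [Fintype S] [Nonempty S] [DecidableEq S]
  [TopologicalSpace S] [DiscreteTopology S]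
  [MeasurableSpace S] [MeasurableSingletonClass S]

/-- The configuration obtained from `x` by replacing its coordinates on `Λ` by `ζ`. -/
def ov (x : Conf S) (Λ : Finset ℤ) (ζ : Λ → S) : Conf S :=
  fun i => if h : i ∈ Λ then ζ ⟨i, h⟩ else x i

/-- The configuration `x'_Λ x_{Λᶜ}`, agreeing with `x'` on `Λ` and with `x` off `Λ`. -/
def merge (Λ : Finset ℤ) (x' x : Conf S) : Conf S :=
  fun i => if i ∈ Λ then x' i else x i

/-- The configuration `s_n x`. -/
def upd (s : S) (n : ℤ) (x : Conf S) : Conf S :=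
  fun i => if i = n then s else x i

/-- The shift `Tⁿ`:  `(Tⁿ x) i = x (i + n)`. -/
def shift (n : ℤ) (x : Conf S) : Conf S := fun i => x (i + n)

/-- The sub-σ-algebra `ℬ_Λ` of the Borel (= product) σ-algebra, generated by
coordinates in `Λ`. -/
def cylSA (Λ : Set ℤ) : MeasurableSpace (Conf S) :=
  MeasurableSpace.comap (fun x => Λ.restrict x) inferInstance

/-- The cylinder set `[ζ]_Λ`. -/
def cylEvent (Λ : Finset ℤ) (ζ : Λ → S) : Set (Conf S) :=
  {y | ∀ i : Λ, y i = ζ i}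

/-- `r_Λ(f) = sup {f x / f y : x_Λ = y_Λ}`. -/
def rSup (Λ : Set ℤ) (f : Conf S → ℝ) : ℝ :=
  sSup {r : ℝ | ∃ x y : Conf S, (∀ i ∈ Λ, x i = y i) ∧ f x / f y = r}

/-- `r̄_Λ(f) = inf {f x / f y : x_Λ = y_Λ}`. -/
def rInf (Λ : Set ℤ) (f : Conf S → ℝ) : ℝ :=
  sInf {r : ℝ | ∃ x y : Conf S, (∀ i ∈ Λ, x i = y i) ∧ f x / f y = r}

/-- A specification `𝒱 = {φ_Λ}` on `S^ℤ`:  a family of nonnegative Borel functions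
satisfying the normalisation and consistency conditions.  (The value on the empty set
is normalised to `1`, which is forced by the unguarded normalisation condition.) -/
structure Specification (A : Type) [Fintype A] [MeasurableSpace A] where
  φ : Finset ℤ → Conf A → ℝ
  nonneg : ∀ Λ x, 0 ≤ φ Λ x
  measurable : ∀ Λ, Measurable (φ Λ)
  sum_one : ∀ (Λ : Finset ℤ) (x : Conf A), ∑ ζ : Λ → A, φ Λ (ov x Λ ζ) = 1
  consistent : ∀ (K Λ : Finset ℤ), K ⊆ Λ → ∀ x : Conf A,
    φ Λ x = φ K x * ∑ ζ : K → A, φ Λ (ov x K ζ)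

/-- A positive specification. -/
def Specification.Positive (V : Specification S) : Prop := ∀ Λ x, 0 < V.φ Λ x

/-- A continuous specification. -/
def Specification.IsCont (V : Specification S) : Prop := ∀ Λ, Continuous (V.φ Λ)

/-- A `T`-invariant specification: `φ_{n+Λ}(x) = φ_Λ(Tⁿ x)`. -/
def Specification.TInvariant (V : Specification S) : Prop :=
  ∀ (n : ℤ) (Λ : Finset ℤ) (x : Conf S),
    V.φ (Λ.image fun i => n + i) x = V.φ Λ (shift n x)

/-- The DLR (Gibbs) condition for a family `φfam` of conditional probabilities:
for each finite nonempty `Λ` and each pattern `ζ` on `Λ`, the conditional probability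
of the cylinder `[ζ]_Λ` given `ℬ_{Λᶜ}` is `x ↦ φfam Λ (ζ x_{Λᶜ})`, `μ`-a.e. -/
def GibbsCond (φfam : Finset ℤ → Conf S → ℝ) (μ : Measure (Conf S)) : Prop :=
  ∀ (Λ : Finset ℤ), Λ.Nonempty → ∀ ζ : Λ → S,
    (fun x => φfam Λ (ov x Λ ζ)) =ᵐ[μ]
      μ[(cylEvent Λ ζ).indicator (fun _ => (1 : ℝ)) | cylSA ((↑Λ : Set ℤ)ᶜ)]

/-- `μ` is a Gibbs state for the specification `V`. -/
def IsGibbs (V : Specification S) (μ : Measure (Conf S)) : Prop :=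
  IsProbabilityMeasure μ ∧ GibbsCond V.φ μ

/-- `g ∈ 𝒢_X`: a nonnegative bounded `ℬ_{ℤ⁻}`-measurable function with
`∑_{s ∈ S} g (s_0 x) = 1`. -/
def MemG (g : Conf S → ℝ) : Prop :=
  (∃ C, ∀ x, |g x| ≤ C) ∧ (∀ x, 0 ≤ g x) ∧
    Measurable[cylSA (Set.Iic (0 : ℤ))] g ∧
    ∀ x : Conf S, ∑ s : S, g (upd s 0 x) = 1

/-- `μ` is a `g`-chain: for every `n` the conditional probability of the symbol at
site `n` given `ℬ_{(-∞,n-1]}` is `x ↦ g (Tⁿ (s_n x))`, `μ`-a.e. -/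
def IsGChain (g : Conf S → ℝ) (μ : Measure (Conf S)) : Prop :=
  IsProbabilityMeasure μ ∧ ∀ (n : ℤ) (s : S),
    (fun x => g (shift n (upd s n x))) =ᵐ[μ]
      μ[({y : Conf S | y n = s}).indicator (fun _ => (1 : ℝ)) | cylSA (Set.Iic (n - 1))]

/-- The probability `π^𝒱_{[0,n]}([x]_{{0}} | x)`. -/
def piG (V : Specification S) (n : ℕ) (x : Conf S) : ℝ :=
  ∑ ζ : (Finset.Icc (0 : ℤ) (n : ℤ)) → S,
    V.φ (Finset.Icc (0 : ℤ) (n : ℤ)) (ov x (Finset.Icc (0 : ℤ) (n : ℤ)) ζ) *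
      (if ov x (Finset.Icc (0 : ℤ) (n : ℤ)) ζ 0 = x 0 then 1 else 0)

/-- A specification sequence of the form `{([0,n], f_n)}`: each `f_n` is bounded,
strictly positive and `ℬ_{[0,n-1]ᶜ}`-measurable. -/
def IsSpecSeq (f : ℕ → Conf S → ℝ) : Prop :=
  ∀ n : ℕ, (∃ C, ∀ x, f n x ≤ C) ∧ (∀ x, 0 < f n x) ∧
    Measurable[cylSA ((Set.Ico (0 : ℤ) (n : ℤ))ᶜ)] (f n)

/-- `{([0,n], f_n)}` is a specification sequence for the family `φfam`. -/
def IsSpecSeqForFam (φfam : Finset ℤ → Conf S → ℝ) (f : ℕ → Conf S → ℝ) : Prop :=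
  IsSpecSeq f ∧ ∀ (n : ℕ) (x : Conf S),
    φfam (Finset.Icc (0 : ℤ) (n : ℤ)) x =
      (∏ j ∈ Finset.range (n + 1), f j x) /
        ∑ ζ : (Finset.Icc (0 : ℤ) (n : ℤ)) → S,
          ∏ j ∈ Finset.range (n + 1), f j (ov x (Finset.Icc (0 : ℤ) (n : ℤ)) ζ)

/-- `{([0,n], f_n)}` is a specification sequence for the specification `V`. -/
def IsSpecSeqFor (V : Specification S) (f : ℕ → Conf S → ℝ) : Prop :=
  IsSpecSeqForFam V.φ f

/-- The operator `L_{m,n} h (x) = ∑_{y ∈ [x]_{[m,n]ᶜ}} (∏_{i=m}^n f_i y) · h y`. -/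
def Lop (f : ℕ → Conf S → ℝ) (m n : ℕ) (h : Conf S → ℝ) (x : Conf S) : ℝ :=
  ∑ ζ : (Finset.Icc (m : ℤ) (n : ℤ)) → S,
    (∏ i ∈ Finset.Icc m n, f i (ov x (Finset.Icc (m : ℤ) (n : ℤ)) ζ)) *
      h (ov x (Finset.Icc (m : ℤ) (n : ℤ)) ζ)

/-- The ratio bounds `ρ_k^{(n)}(x,y)` (with `ρ_{-1}^{(n)}` for negative `k`). -/
def rho (f : ℕ → Conf S → ℝ) (k : ℤ) (n : ℕ) (x y : Conf S) : ℝ :=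
  if k < 0 then
    sInf {r : ℝ | ∃ m : ℕ,
      Lop f m (m + n) (fun _ => 1) x / Lop f m (m + n) (fun _ => 1) y = r}
  else
    sInf {r : ℝ | ∃ (m : ℕ) (ζ : (Finset.Icc (m : ℤ) ((m : ℤ) + k)) → S),
      Lop f m (m + n) ((cylEvent (Finset.Icc (m : ℤ) ((m : ℤ) + k)) ζ).indicator
          fun _ => 1) x /
        Lop f m (m + n) ((cylEvent (Finset.Icc (m : ℤ) ((m : ℤ) + k)) ζ).indicator
          fun _ => 1) y = r}

/-- A `T`-invariant interaction potential `Φ = {Φ_Λ}`. -/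
structure Potential (A : Type) [Fintype A] [MeasurableSpace A] where
  Φ : Finset ℤ → Conf A → ℝ
  measurable : ∀ Λ : Finset ℤ, Λ.Nonempty → Measurable[cylSA (↑Λ : Set ℤ)] (Φ Λ)
  bounded : ∀ Λ : Finset ℤ, ∃ C, ∀ x, |Φ Λ x| ≤ C
  invariant : ∀ (n : ℤ) (Λ : Finset ℤ), Λ.Nonempty → ∀ x : Conf A,
    Φ (Λ.image fun i => n + i) x = Φ Λ (shift n x)

/-- `var(h) = sup h − inf h`. -/
def pvar (h : Conf S → ℝ) : ℝ := (⨆ x, h x) - ⨅ x, h x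

/-- `‖h‖ = sup |h|`. -/
def pnorm (h : Conf S → ℝ) : ℝ := ⨆ x, |h x|

/-- `∑_{Λ ∋ 0} ‖Φ_Λ‖ < ∞`. -/
def NormSummable (P : Potential S) : Prop :=
  Summable fun Λ : {Λ : Finset ℤ // (0 : ℤ) ∈ Λ} => pnorm (P.Φ ↑Λ)

/-- `∑_{Λ ∋ 0, Λ ∩ [n,∞) ≠ ∅} var(Φ_Λ)`. -/
def varTail (P : Potential S) (n : ℕ) : ℝ :=
  ∑' Λ : {Λ : Finset ℤ // (0 : ℤ) ∈ Λ ∧ ∃ i ∈ Λ, (n : ℤ) ≤ i}, pvar (P.Φ ↑Λ)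

/-- The Hamiltonian `H_Λ(x) = ∑_{K ∩ Λ ≠ ∅} Φ_K(x)`. -/
def HPot (P : Potential S) (Λ : Finset ℤ) (x : Conf S) : ℝ :=
  ∑' K : {K : Finset ℤ // (K ∩ Λ).Nonempty}, P.Φ ↑K x

/-- The specification `𝒱_Φ` associated with an interaction potential. -/
def potPhi (P : Potential S) (Λ : Finset ℤ) (x : Conf S) : ℝ :=
  Real.exp (-HPot P Λ x) / ∑ ζ : Λ → S, Real.exp (-HPot P Λ (ov x Λ ζ))

/-- `μ` is a Gibbs state for the potential `P`. -/
def IsGibbsPot (P : Potential S) (μ : Measure (Conf S)) : Prop :=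
  IsProbabilityMeasure μ ∧ GibbsCond (potPhi P) μ

/-- `(T,μ)` is Bernoulli: the shift on `(S^ℤ, μ)` is measure-theoretically isomorphic
(mod 0) to the shift on `A^ℤ` carrying an i.i.d. product probability measure for some
finite alphabet `A` (wlog `A = Fin m`). -/
def IsBernoulliSystem (μ : Measure (Conf S)) : Prop :=
  ∃ (m : ℕ) (p : Fin m → ENNReal) (ν : Measure (ℤ → Fin m)),
    IsProbabilityMeasure ν ∧ (∑ a, p a = 1) ∧
    (∀ (Λ : Finset ℤ) (ζ : Λ → Fin m),
      ν {y : ℤ → Fin m | ∀ i : Λ, y ↑i = ζ i} = ∏ i : Λ, p (ζ i)) ∧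
    ∃ (θ : Conf S → ℤ → Fin m) (θinv : (ℤ → Fin m) → Conf S),
      Measurable θ ∧ Measurable θinv ∧ μ.map θ = ν ∧
      (∀ᵐ x ∂μ, θ (shift 1 x) = fun i => θ x (i + 1)) ∧
      (∀ᵐ x ∂μ, θinv (θ x) = x) ∧ (∀ᵐ y ∂ν, θ (θinv y) = y)

/-- The recursively defined quantities `p_k^{(n)}` of Lemma 3.3 (`k = -1` is encoded
by any negative argument). -/
def pSeq (v : ℕ → ℝ) : ℕ → ℤ → ℝ
  | 0, k => if k < 0 then 1 else v 0
  | n + 1, k =>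
    if k < 0 then 1
    else v k.toNat * pSeq v n (k - 1) +
      ∑ j ∈ Finset.Ico k.toNat (n + 1), (v (j + 1) - v j) * pSeq v n (j : ℤ)


/-- Two configurations agreeing off `Λ` have the same overwrites on `Λ`. -/
theorem ov_congr {A : Type} {Λ : Finset ℤ} {x y : Conf A} (hxy : ∀ i, i ∉ Λ → x i = y i)
    (ζ : Λ → A) : ov x Λ ζ = ov y Λ ζ := by
  funext i
  by_cases hi : i ∈ Λ
  · simp [ov, hi]
  · simp [ov, hi, hxy i hi]

/-- If two positive specifications agree on `K ⊆ Λ`, the ratio of their `Λ`-functions does not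
depend on the coordinates in `K`. -/
theorem Specification.div_eq_div_of_subset {A : Type} [Fintype A] [MeasurableSpace A]
    (V W : Specification A) {K Λ : Finset ℤ} (hK : K ⊆ Λ) (hW : ∀ x, W.φ K x ≠ 0)
    (h : ∀ x, V.φ K x = W.φ K x) {x y : Conf A} (hxy : ∀ i, i ∉ K → x i = y i) :
    V.φ Λ x / W.φ Λ x = V.φ Λ y / W.φ Λ y := by
  rw [V.consistent K Λ hK x, W.consistent K Λ hK x, V.consistent K Λ hK y,
    W.consistent K Λ hK y, h x, h y, mul_div_mul_left _ _ (hW x), mul_div_mul_left _ _ (hW y)]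
  simp only [ov_congr hxy]

/-- A function unaffected by changing any single coordinate in `K` is unaffected by changing
all the coordinates in `K`. -/
theorem eq_of_forall_singleton {A B : Type} (R : Conf A → B) (K : Finset ℤ)
    (hR : ∀ n ∈ K, ∀ x y : Conf A, (∀ i, i ∉ ({n} : Finset ℤ) → x i = y i) → R x = R y)
    {x y : Conf A} (hxy : ∀ i, i ∉ K → x i = y i) : R x = R y := by
  induction K using Finset.induction_on generalizing x with
  | empty => exact congrArg R (funext fun i => hxy i (Finset.notMem_empty i))
  | insert n K _ ih =>
    have hupd : R x = R (Function.update x n (y n)) :=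
      hR n (Finset.mem_insert_self n K) _ _ fun i hi => by
        rw [Function.update_of_ne (by simpa using hi)]
    refine hupd.trans (ih (fun m hm => hR m (Finset.mem_insert_of_mem hm)) fun i hi => ?_)
    by_cases hin : i = n
    · subst hin
      simp
    · rw [Function.update_of_ne hin]
      exact hxy i (by simp [hin, hi])

/-- A positive specification is completely determined by its single-site functions. -/
theorem spec_determined_by_singletons
    {S : Type} [Fintype S] [Nonempty S] [DecidableEq S]
    [TopologicalSpace S] [DiscreteTopology S]
    [MeasurableSpace S] [MeasurableSingletonClass S]
    (V W : Specification S) (hV : V.Positive) (hW : W.Positive)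
    (h : ∀ (n : ℤ) (x : Conf S), V.φ {n} x = W.φ {n} x) :
    ∀ (Λ : Finset ℤ) (x : Conf S), V.φ Λ x = W.φ Λ x := by
  intro Λ x
  have hratio (ζ : Λ → S) :
      V.φ Λ (ov x Λ ζ) = V.φ Λ x / W.φ Λ x * W.φ Λ (ov x Λ ζ) := by
    rw [← div_eq_iff (hW Λ _).ne']
    refine eq_of_forall_singleton (fun z => V.φ Λ z / W.φ Λ z) Λ (fun n hn y z hyz => ?_)
      fun i hi => by simp [ov, hi]
    exact V.div_eq_div_of_subset W (Finset.singleton_subset_iff.mpr hn)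
      (fun u => (hW {n} u).ne') (h n) hyz
  have hsum := V.sum_one Λ x
  simp only [hratio] at hsum
  rw [← Finset.mul_sum, W.sum_one, mul_one] at hsum
  exact (div_eq_one_iff_eq (hW Λ x).ne').mp hsum
end GibbsFormal
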